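/- arXiv:2005.11571 — 2 statements merged into one kernel-verified Lean document; each statement's English description precedes it below -/
import Mathlib

section
/- Assume H is normal in G. Then {x ∈ T^H·e_H : β_g(x·e_H·β_{g⁻¹}(e_H)) = x·e_H·β_g(e_H) for all g ∈ G} = T^G·e_H. In other words, the subring of invariants of the ideal T^H·e_H under the partial action of G/H obtained by restricting the induced G/H-action on T^H equals T^G·e_H. -/
open Finset

variable {T : Type*} [CommRing T] {G : Type*} [Group G]

/-- The idempotents `e_i` associated to the enumeration `h` of the subgroup `H`:
`e_1 = 1_S` and `e_i = (1 - β_{h_1}(1_S))⋯(1 - β_{h_{i-1}}(1_S))·β_{h_i}(1_S)`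
(0-based indexing, with `h 0 = 1`). -/
def eIdem (β : G →* RingAut T) (oneS : T) {m : ℕ} (h : Fin (m + 1) → G)
    (i : Fin (m + 1)) : T :=
  (∏ j ∈ Finset.univ.filter (fun j => j < i), (1 - β (h j) oneS)) * β (h i) oneS

/-- The map `ψ_H : T → T`, `ψ_H(t) = Σ_i β_{h_i}(t)·e_i`. -/
def psiH (β : G →* RingAut T) (oneS : T) {m : ℕ} (h : Fin (m + 1) → G) (t : T) : T :=
  ∑ i : Fin (m + 1), β (h i) t * eIdem β oneS h i


/-- The fixed subring `T^H = {t ∈ T : β_h(t) = t for all h ∈ H}`. -/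
def TFix (β : G →* RingAut T) (H : Subgroup G) : Set T :=
  {t : T | ∀ g ∈ H, β g t = t}

/-- The invariants `S^{α_H} = {s ∈ S : β_h(s)·1_S = s·1_h for all h ∈ H}`,
where `1_h = β_h(1_S)·1_S`. -/
def SinvH (β : G →* RingAut T) (oneS : T) (H : Subgroup G) : Set T :=
  {s : T | s * oneS = s ∧ ∀ g ∈ H, β g s * oneS = s * (β g oneS * oneS)}

theorem eIdem_sq_aux {T : Type*} [CommRing T] {G : Type*} [Group G]
    (β : G →* RingAut T) (oneS : T) (honeS : oneS * oneS = oneS) (g : G) :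
    β g oneS * β g oneS = β g oneS := by
  rw [← map_mul, honeS]

theorem eIdem_orth_aux {T : Type*} [CommRing T] {G : Type*} [Group G]
    (β : G →* RingAut T) (oneS : T) (honeS : oneS * oneS = oneS) {m : ℕ}
    (h : Fin (m + 1) → G) (i j : Fin (m + 1)) (hij : i < j) :
    eIdem β oneS h i * eIdem β oneS h j = 0 := by
  have hd : (1 - β (h i) oneS) ∣ eIdem β oneS h j := by
    unfold eIdem
    apply Dvd.dvd.mul_right
    exact Finset.dvd_prod_of_mem (fun j => 1 - β (h j) oneS) (by simp [hij])
  obtain ⟨c, hc⟩ := hd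
  rw [hc, eIdem]
  have := eIdem_sq_aux β oneS honeS (h i)
  linear_combination (-(∏ j ∈ Finset.univ.filter (fun j => j < i), (1 - β (h j) oneS)) * c) * this

theorem psiH_idem_aux {T : Type*} [CommRing T] {G : Type*} [Group G]
    (β : G →* RingAut T) (oneS : T) (honeS : oneS * oneS = oneS) {m : ℕ}
    (h : Fin (m + 1) → G) :
    psiH β oneS h oneS * psiH β oneS h oneS = psiH β oneS h oneS := by
  have hs : psiH β oneS h oneS = ∑ i, eIdem β oneS h i := by
    unfold psiH
    refine Finset.sum_congr rfl fun i _ => ?_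
    unfold eIdem
    have := eIdem_sq_aux β oneS honeS (h i)
    linear_combination (∏ j ∈ Finset.univ.filter (fun j => j < i), (1 - β (h j) oneS)) * this
  rw [hs]
  have ho : OrthogonalIdempotents (eIdem β oneS h) := by
    refine ⟨fun i => ?_, fun i j hij => ?_⟩
    · have h2 := eIdem_sq_aux β oneS honeS (h i)
      have h3 : IsIdempotentElem
          (∏ j ∈ Finset.univ.filter (fun j => j < i), (1 - β (h j) oneS)) := by
        unfold IsIdempotentElem
        rw [← Finset.prod_mul_distrib]
        refine Finset.prod_congr rfl fun j _ => ?_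
        linear_combination eIdem_sq_aux β oneS honeS (h j)
      exact IsIdempotentElem.mul h3 h2
    · rcases lt_or_gt_of_ne hij with hlt | hlt
      · exact eIdem_orth_aux β oneS honeS h i j hlt
      · change eIdem β oneS h i * eIdem β oneS h j = 0
        rw [mul_comm]
        exact eIdem_orth_aux β oneS honeS h j i hlt
  exact ho.isIdempotentElem_sum

/-- Gluing a compatible family of sections over idempotents. -/
theorem glue_aux {T : Type*} [CommRing T] {G : Type*} (e x : G → T)
    (he : ∀ g, e g * e g = e g) (hx : ∀ g, x g * e g = x g)
    (hc : ∀ a b, x a * e b = x b * e a) (A : Finset G) :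
    ∃ t : T, (∀ g ∈ A, t * e g = x g) ∧ t * ∏ g ∈ A, (1 - e g) = 0 := by
  classical
  induction A using Finset.induction_on with
  | empty => exact ⟨0, by simp, by simp⟩
  | insert a A ha ih =>
    obtain ⟨t, ht, hp⟩ := ih
    refine ⟨x a + t * (1 - e a), ?_, ?_⟩
    · intro g hg
      rcases Finset.mem_insert.1 hg with rfl | hg
      · linear_combination hx g - t * he g
      · linear_combination hc a g + (1 - e a) * ht g hg
    · rw [Finset.prod_insert ha]
      linear_combination (1 - e a) ^ 2 * hp - (∏ g ∈ A, (1 - e g)) * hx a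

theorem glue_unique_aux {T : Type*} [CommRing T] {G : Type*} (e : G → T) (d : T)
    (A : Finset G) (hd : ∀ g ∈ A, d * e g = 0) : d * ∏ g ∈ A, (1 - e g) = d := by
  classical
  induction A using Finset.induction_on with
  | empty => simp
  | insert a A ha ih =>
    rw [Finset.prod_insert ha]
    have h1 := ih fun g hg => hd g (Finset.mem_insert_of_mem hg)
    have h2 := hd a (Finset.mem_insert_self _ _)
    linear_combination (1 - e a) * h1 - h2

/-- for `H` normal in `G`, the invariants of the ideal `T^H·e_H` under the
partial action of `G/H` (obtained by restricting the induced `G/H`-action on `T^H`)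
equal `T^G·e_H`. -/
theorem invariants_of_quotient_partial_action {T : Type*} [CommRing T]
    {G : Type*} [Group G] [Fintype G]
    (β : G →* RingAut T) (oneS : T) (honeS : oneS * oneS = oneS)
    (H : Subgroup G) (hN : H.Normal) {m : ℕ} (h : Fin (m + 1) → G)
    (hinj : Function.Injective h) (hrange : Set.range h = (H : Set G))
    (h1 : h 0 = 1) :
    {x : T | (∃ t ∈ TFix β H, x = t * psiH β oneS h oneS) ∧
        ∀ g : G, β g (x * psiH β oneS h oneS * β g⁻¹ (psiH β oneS h oneS)) =
          x * psiH β oneS h oneS * β g (psiH β oneS h oneS)} =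
      (fun t => t * psiH β oneS h oneS) '' TFix β (⊤ : Subgroup G) := by
  have he := psiH_idem_aux β oneS honeS h
  generalize psiH β oneS h oneS = e at he ⊢
  have hgg : ∀ (g : G) (y : T), β g (β g⁻¹ y) = y := fun g y => by
    rw [← RingAut.mul_apply, ← map_mul]; simp
  have hmul : ∀ (a b : G) (y : T), β (a * b) y = β a (β b y) := fun a b y => by
    rw [map_mul, RingAut.mul_apply]
  ext x
  constructor
  · rintro ⟨⟨s, -, hs⟩, hinv⟩
    have hxe : x * e = x := by rw [hs, mul_assoc, he]
    have hinv' : ∀ g, β g x * e = x * β g e := fun g => by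
      have := hinv g
      rwa [map_mul, hgg, hxe] at this
    have hcomp : ∀ a b, β a x * β b e = β b x * β a e := fun a b => by
      have := congrArg (β b) (hinv' (b⁻¹ * a))
      rwa [map_mul (β b), map_mul (β b), ← hmul, ← hmul, mul_inv_cancel_left] at this
    obtain ⟨t, ht, hp⟩ := glue_aux (fun g => β g e) (fun g => β g x)
      (fun g => by rw [← map_mul, he]) (fun g => by rw [← map_mul, hxe]) hcomp Finset.univ
    refine ⟨t, fun g _ => ?_, ?_⟩
    · have hd : ∀ k ∈ (Finset.univ : Finset G), (β g t - t) * β k e = 0 := fun k _ => by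
        have h2 := congrArg (β g) (ht (g⁻¹ * k) (Finset.mem_univ _))
        simp only [map_mul (β g), ← hmul, mul_inv_cancel_left] at h2
        rw [sub_mul, h2, ht k (Finset.mem_univ _), sub_self]
      have hu := glue_unique_aux (fun g => β g e) _ _ hd
      have hprod : β g (∏ k, (1 - β k e)) = ∏ k, (1 - β k e) := by
        rw [map_prod]
        refine Fintype.prod_equiv (Equiv.mulLeft g) _ _ fun k => ?_
        simp [hmul]
      have hp2 := congrArg (β g) hp
      rw [map_mul, hprod, map_zero] at hp2
      rw [sub_mul, hp2, hp, sub_self] at hu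
      exact (sub_eq_zero.1 hu.symm)
    · simpa using ht 1 (Finset.mem_univ _)
  · rintro ⟨t, ht, rfl⟩
    refine ⟨⟨t, fun g _ => ht g trivial, rfl⟩, fun g => ?_⟩
    simp only [map_mul (β g), hgg, ht g trivial]
    have h2 : β g e * β g e = β g e := by rw [← map_mul, he]
    linear_combination t * e * h2 - t * β g e * he
end

section
/- Assume H is normal in G. Then the subring of invariants of S^{α_H} under the induced partial action α_{G/H} of G/H equals S^α; that is, {s ∈ S^{α_H} : α_{gH}(s·1̃_{g⁻¹H}) = s·1̃_{gH} for all g ∈ G} = {s ∈ S : β_g(s)·1_S = s·1_g for all g ∈ G}. -/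
open Finset

variable {T : Type*} [CommRing T] {G : Type*} [Group G]

/-- The idempotent `1̃_{gH} = β_g(e_H)·1_S` of `S^{α_H}`. -/
def tilde1 (β : G →* RingAut T) (oneS : T) {m : ℕ} (h : Fin (m + 1) → G) (g : G) : T :=
  β g (psiH β oneS h oneS) * oneS

/-- The ideal `D̃_{gH} = S^{α_H}·1̃_{gH}` of `S^{α_H}`. -/
def DtH (β : G →* RingAut T) (oneS : T) (H : Subgroup G) {m : ℕ}
    (h : Fin (m + 1) → G) (g : G) : Set T :=
  (fun s => s * tilde1 β oneS h g) '' SinvH β oneS H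

/-- The map `α_{gH} : D̃_{g⁻¹H} → D̃_{gH}`, `α_{gH}(x) = β_g(ψ_H(x))·1_S`. -/
def aMapH (β : G →* RingAut T) (oneS : T) {m : ℕ} (h : Fin (m + 1) → G)
    (g : G) (x : T) : T :=
  β g (psiH β oneS h x) * oneS


lemma aux_psi_one (β : G →* RingAut T) (oneS : T) (honeS : oneS * oneS = oneS) {m : ℕ}
    (h : Fin (m + 1) → G) :
    psiH β oneS h oneS = 1 - ∏ i, (1 - β (h i) oneS) := by
  rw [Finset.prod_one_sub_ordered]
  unfold psiH eIdem
  rw [sub_sub_cancel]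
  refine Finset.sum_congr rfl fun i _ => ?_
  have : β (h i) oneS * β (h i) oneS = β (h i) oneS := by rw [← map_mul, honeS]
  linear_combination (∏ j ∈ Finset.univ.filter (fun j => j < i), (1 - β (h j) oneS)) * this

lemma aux_e_mul (β : G →* RingAut T) (oneS : T) (honeS : oneS * oneS = oneS) {m : ℕ}
    (h : Fin (m + 1) → G) (i : Fin (m + 1)) :
    β (h i) oneS * eIdem β oneS h i = eIdem β oneS h i := by
  unfold eIdem
  have : β (h i) oneS * β (h i) oneS = β (h i) oneS := by rw [← map_mul, honeS]
  linear_combination (∏ j ∈ Finset.univ.filter (fun j => j < i), (1 - β (h j) oneS)) * this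

lemma aux_E_mul (β : G →* RingAut T) (oneS : T) (honeS : oneS * oneS = oneS) {m : ℕ}
    (h : Fin (m + 1) → G) (i : Fin (m + 1)) :
    psiH β oneS h oneS * β (h i) oneS = β (h i) oneS := by
  rw [aux_psi_one β oneS honeS, ← Finset.mul_prod_erase _ _ (Finset.mem_univ i)]
  have : β (h i) oneS * β (h i) oneS = β (h i) oneS := by rw [← map_mul, honeS]
  linear_combination (∏ j ∈ Finset.univ.erase i, (1 - β (h j) oneS)) * this

lemma aux_E_inv (β : G →* RingAut T) (oneS : T) (honeS : oneS * oneS = oneS)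
    (H : Subgroup G) {m : ℕ} (h : Fin (m + 1) → G)
    (hinj : Function.Injective h) (hrange : Set.range h = (H : Set G)) (k : G) (hk : k ∈ H) :
    β k (psiH β oneS h oneS) = psiH β oneS h oneS := by
  have hm : ∀ i, h i ∈ H := fun i => by
    have : h i ∈ Set.range h := ⟨i, rfl⟩
    rwa [hrange] at this
  have hs : ∀ x ∈ H, ∃ i, h i = x := fun x hx => by
    have : x ∈ Set.range h := by rw [hrange]; exact hx
    exact this
  rw [aux_psi_one β oneS honeS, map_sub, map_one, map_prod]
  congr 1
  choose f hf using fun i => hs (k * h i) (H.mul_mem hk (hm i))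
  have hfi : Function.Injective f := fun a b hab => by
    have := hf b
    rw [← hab, hf a] at this
    exact hinj (mul_left_cancel this)
  refine Fintype.prod_bijective f (Finite.injective_iff_bijective.mp hfi) _ _ fun i => ?_
  rw [hf, map_sub, map_one, map_mul]
  rfl

/-- for `H` normal in `G`, the invariants of `S^{α_H}` under the induced
partial action `α_{G/H}` of `G/H` equal `S^α`. -/
theorem invariants_quotient_eq_Salpha {T : Type*} [CommRing T] {G : Type*} [Group G]
    [Fintype G]
    (β : G →* RingAut T) (oneS : T) (honeS : oneS * oneS = oneS)
    (H : Subgroup G) (hN : H.Normal) {m : ℕ} (h : Fin (m + 1) → G)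
    (hinj : Function.Injective h) (hrange : Set.range h = (H : Set G))
    (h1 : h 0 = 1) :
    {s : T | s ∈ SinvH β oneS H ∧
        ∀ g : G, aMapH β oneS h g (s * tilde1 β oneS h g⁻¹) = s * tilde1 β oneS h g} =
      {s : T | s * oneS = s ∧ ∀ g : G, β g s * oneS = s * (β g oneS * oneS)} := by
  have hm : ∀ i, h i ∈ H := fun i => by
    have : h i ∈ Set.range h := ⟨i, rfl⟩
    rwa [hrange] at this
  have hmul : ∀ (a b : G) (t : T), β (a * b) t = β a (β b t) := fun a b t => by
    rw [map_mul]; rfl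
  have hone : ∀ t : T, β 1 t = t := fun t => by rw [map_one]; rfl
  have hE1 : psiH β oneS h oneS * oneS = oneS := by
    have := aux_E_mul β oneS honeS h 0
    rwa [h1, hone] at this
  have hEsum : psiH β oneS h oneS = ∑ i, eIdem β oneS h i :=
    Finset.sum_congr rfl fun i _ => aux_e_mul β oneS honeS h i
  -- the map of the quotient action on invariants
  have key : ∀ (s : T), s * oneS = s → ∀ g : G,
      aMapH β oneS h g (s * tilde1 β oneS h g⁻¹) = β g (psiH β oneS h s) * oneS := by
    intro s hs g
    have h2 : psiH β oneS h (s * tilde1 β oneS h g⁻¹)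
        = psiH β oneS h s * β g⁻¹ (psiH β oneS h oneS) := by
      conv_lhs => unfold psiH
      conv_rhs => enter [1]; unfold psiH
      rw [Finset.sum_mul]
      refine Finset.sum_congr rfl fun i _ => ?_
      have h3 : β (h i) (β g⁻¹ (psiH β oneS h oneS)) = β g⁻¹ (psiH β oneS h oneS) := by
        rw [← hmul, show h i * g⁻¹ = g⁻¹ * (g * h i * g⁻¹) by group, hmul,
          aux_E_inv β oneS honeS H h hinj hrange _ (hN.conj_mem _ (hm i) g)]
      have h4 := aux_e_mul β oneS honeS h i
      unfold tilde1
      rw [map_mul, map_mul, h3]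
      linear_combination (β (h i) s * β g⁻¹ (psiH β oneS h oneS)) * h4
    unfold aMapH
    rw [h2, map_mul, ← hmul, mul_inv_cancel, hone, mul_assoc, hE1]
  ext s
  simp only [Set.mem_setOf_eq, SinvH]
  constructor
  · rintro ⟨⟨hs, hH⟩, hg⟩
    refine ⟨hs, fun g => ?_⟩
    have h5 := hg g
    rw [key s hs] at h5
    have h6 : psiH β oneS h s * oneS = s := by
      have h7 : psiH β oneS h s * oneS = s * ∑ i, eIdem β oneS h i := by
        unfold psiH
        rw [Finset.sum_mul, Finset.mul_sum]
        refine Finset.sum_congr rfl fun i _ => ?_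
        have h8 := hH (h i) (hm i)
        have h4 := aux_e_mul β oneS honeS h i
        linear_combination (eIdem β oneS h i) * h8 + s * oneS * h4 + eIdem β oneS h i * hs
      rw [h7, ← hEsum]
      linear_combination s * hE1 + (1 - psiH β oneS h oneS) * hs
    have h9 : β g (psiH β oneS h s) * β g oneS = β g s := by rw [← map_mul, h6]
    have h10 : β g (psiH β oneS h oneS) * β g oneS = β g oneS := by rw [← map_mul, hE1]
    unfold tilde1 at h5
    linear_combination β g oneS * h5 - oneS * h9 + s * oneS * h10
  · rintro ⟨hs, hg⟩
    refine ⟨⟨hs, fun g _ => hg g⟩, fun g => ?_⟩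
    rw [key s hs]
    unfold tilde1
    rw [hEsum]
    unfold psiH
    rw [map_sum, map_sum, Finset.sum_mul, Finset.sum_mul, Finset.mul_sum]
    refine Finset.sum_congr rfl fun i _ => ?_
    have h11 := hg (g * h i)
    rw [hmul, hmul] at h11
    have h4 := congrArg (β g) (aux_e_mul β oneS honeS h i)
    rw [map_mul] at h4
    rw [map_mul]
    linear_combination β g (eIdem β oneS h i) * h11 + s * oneS * h4
end
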